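/- Let M > 0. For any nonzero real ξ with |ξ| ≤ M and any sequence (η_n)_{n≥1} of real numbers, there exist a constant γ > 0 depending only on M and arbitrarily small positive real numbers ε such that for all positive integers n, ‖ξ(1+ε)^n + η_n‖ > γ · ε / |log ε|. -/

import Mathlib

open MeasureTheory Set

lemma aux_exp_lower (ξ : ℝ) (hξ : 0 < ξ) (n : ℕ) (x y : ℝ) :
    ξ * n * Real.exp (n * x) * (y - x) ≤ ξ * Real.exp (n * y) - ξ * Real.exp (n * x) := by
  have h1 := Real.add_one_le_exp (n * y - n * x)
  have h2 : Real.exp (n * y) = Real.exp (n * x) * Real.exp (n * y - n * x) := by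
    rw [← Real.exp_add]; congr 1; ring
  rw [h2]
  have h3 := mul_le_mul_of_nonneg_left h1 (mul_pos hξ (Real.exp_pos (n * x))).le
  nlinarith

lemma aux_exp_upper (ξ : ℝ) (hξ : 0 < ξ) (n : ℕ) (x y : ℝ) :
    ξ * Real.exp (n * y) - ξ * Real.exp (n * x) ≤ ξ * n * Real.exp (n * y) * (y - x) := by
  have := aux_exp_lower ξ hξ n y x
  linarith

lemma aux_diam (S : Set ℝ) (d : ℝ) (hd : 0 ≤ d) (h : ∀ x ∈ S, ∀ y ∈ S, x ≤ y → y - x ≤ d) :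
    volume.real S ≤ d := by
  have h1 : volume S ≤ ENNReal.ofReal d := by
    refine (Real.volume_le_diam S).trans ?_
    refine Metric.ediam_le ?_
    intro x hx y hy
    rw [edist_dist]
    apply ENNReal.ofReal_le_ofReal
    rw [Real.dist_eq]
    rcases le_total x y with hxy | hxy
    · rw [abs_sub_comm, abs_of_nonneg (by linarith)]; exact h x hx y hy hxy
    · rw [abs_of_nonneg (by linarith)]; exact h y hy x hx hxy
  exact ENNReal.toReal_le_of_le_ofReal hd h1

lemma aux_mono {S T : Set ℝ} (a b : ℝ) (h : S ⊆ T) (hT : T ⊆ Icc a b) :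
    volume.real S ≤ volume.real T := by
  refine measureReal_mono h ?_
  exact ((measure_mono hT).trans_lt (by simp [Real.volume_Icc])).ne

/-- one-interval estimate -/
lemma aux_T (ξ : ℝ) (hξ : 0 < ξ) (n : ℕ) (hn : 1 ≤ n) (η w a b : ℝ) (hw : 0 < w) (m : ℤ) :
    volume.real {t | t ∈ Icc a b ∧ |ξ * Real.exp (n * t) + η - m| ≤ w}
      ≤ 2 * w / (ξ * n * Real.exp (n * a)) := by
  have hn' : (0:ℝ) < n := by exact_mod_cast hn
  have hD : 0 < ξ * n * Real.exp (n * a) := by positivity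
  apply aux_diam _ _ (by positivity)
  rintro x ⟨hx, hx2⟩ y ⟨hy, hy2⟩ hxy
  rw [le_div_iff₀ hD]
  have h1 := aux_exp_lower ξ hξ n x y
  have h2 : Real.exp (n * a) ≤ Real.exp (n * x) := by
    apply Real.exp_le_exp.mpr; exact mul_le_mul_of_nonneg_left hx.1 hn'.le
  have h3 : ξ * n * Real.exp (n * a) * (y - x) ≤ ξ * n * Real.exp (n * x) * (y - x) := by
    have : 0 ≤ y - x := by linarith
    gcongr
  rw [abs_le] at hx2 hy2
  linarith

lemma aux_meas (ξ : ℝ) (hξ : 0 < ξ) (n : ℕ) (hn : 1 ≤ n) (η w a b : ℝ) (hw : 0 < w)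
    (hw2 : w ≤ 1 / 2) (hab : a ≤ b) :
    volume.real {t | t ∈ Icc a b ∧ ∃ m : ℤ, |ξ * Real.exp (n * t) + η - m| ≤ w}
      ≤ 2 * w * (b - a) + 4 * w / (ξ * n * Real.exp (n * a)) := by
  have hn' : (0:ℝ) < n := by exact_mod_cast hn
  set f : ℝ → ℝ := fun t => ξ * Real.exp (n * t) + η with hf
  have hmono : StrictMono f := by
    intro x y hxy
    simp only [hf]
    gcongr
  have hcont : Continuous f := by simp only [hf]; fun_prop
  set m0 : ℤ := ⌈f a - w⌉ with hm0
  have hm0' : f a - w ≤ m0 := Int.le_ceil _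
  obtain ⟨N, hN⟩ := exists_nat_gt (f b + w - m0)
  let T : ℤ → Set ℝ := fun m => {t | t ∈ Icc a b ∧ |f t - m| ≤ w}
  have hp : ∀ i : ℕ, ∃ p ∈ Icc a b, f p = min ((m0 + 2 + i : ℝ) - w - 1) (f b) := by
    intro i
    have := intermediate_value_Icc hab hcont.continuousOn
    apply this
    refine ⟨le_min ?_ (hmono.monotone hab), min_le_right _ _⟩
    have : (0:ℝ) ≤ i := Nat.cast_nonneg i
    linarith
  choose p hpI hpf using hp
  have hpm : ∀ i, p i ≤ p (i+1) := by
    intro i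
    apply hmono.le_iff_le.mp
    rw [hpf, hpf]
    apply min_le_min_right
    push_cast; linarith
  have hTi : ∀ i : ℕ, volume.real (T (m0 + 2 + i)) ≤ 2 * w * (p (i+1) - p i) := by
    intro i
    apply aux_diam
    · have := hpm i
      have : 0 ≤ p (i+1) - p i := by linarith
      positivity
    rintro x ⟨hx, hx2⟩ y ⟨hy, hy2⟩ hxy
    rw [abs_le] at hx2 hy2
    push_cast at hx2 hy2
    have hxb : f x ≤ f b := hmono.monotone hx.2
    have e1 : f (p (i+1)) = (m0 + 2 + i : ℝ) - w := by
      rw [hpf, min_eq_left] <;> push_cast <;> linarith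
    have e0 : f (p i) = (m0 + 2 + i : ℝ) - w - 1 := by
      rw [hpf, min_eq_left]; linarith
    have hqx : p (i+1) ≤ x := by
      apply hmono.le_iff_le.mp; linarith
    have h1 := aux_exp_lower ξ hξ n x y
    have h2 := aux_exp_upper ξ hξ n (p i) (p (i+1))
    have h3 : Real.exp (n * p (i+1)) ≤ Real.exp (n * x) := by
      apply Real.exp_le_exp.mpr; exact mul_le_mul_of_nonneg_left hqx hn'.le
    have hd : 0 ≤ p (i+1) - p i := by linarith [hpm i]
    have h4 : ξ * n * Real.exp (n * p (i+1)) * (p (i+1) - p i)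
        ≤ ξ * n * Real.exp (n * x) * (p (i+1) - p i) := by gcongr
    have hD : 0 < ξ * n * Real.exp (n * x) := by positivity
    have h5 : 1 ≤ ξ * n * Real.exp (n * x) * (p (i+1) - p i) := by
      simp only [hf] at e1 e0; linarith
    have h6 : ξ * n * Real.exp (n * x) * (y - x) ≤ 2 * w := by
      simp only [hf] at hx2 hy2; linarith
    have h7 : ξ * n * Real.exp (n * x) * (y - x) ≤
        ξ * n * Real.exp (n * x) * (2 * w * (p (i+1) - p i)) := by nlinarith
    exact le_of_mul_le_mul_left h7 hD
  have hsub : {t | t ∈ Icc a b ∧ ∃ m : ℤ, |ξ * Real.exp (n * t) + η - m| ≤ w} ⊆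
      (T m0 ∪ T (m0 + 1)) ∪ ⋃ i ∈ Finset.range N, T (m0 + 2 + i) := by
    rintro t ⟨ht, m, hm⟩
    have hm' : |f t - m| ≤ w := hm
    have h1 : m0 ≤ m := by
      apply Int.ceil_le.mpr
      rw [abs_le] at hm'
      have := hmono.monotone ht.1
      linarith
    rcases eq_or_lt_of_le h1 with h | h
    · left; left; subst h; exact ⟨ht, hm'⟩
    rcases eq_or_lt_of_le (show m0 + 1 ≤ m by omega) with h2 | h2
    · left; right; subst h2; exact ⟨ht, hm'⟩
    right
    obtain ⟨i, hi⟩ := Int.eq_ofNat_of_zero_le (show 0 ≤ m - m0 - 2 by omega)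
    have hi' : m = m0 + 2 + i := by omega
    simp only [mem_iUnion, Finset.mem_range]
    refine ⟨i, ?_, ?_⟩
    · rw [abs_le] at hm'
      have := hmono.monotone ht.2
      rw [hi'] at hm'
      push_cast at hm'
      have : (i:ℝ) < N := by linarith
      exact_mod_cast this
    · rw [← hi']; exact ⟨ht, hm'⟩
  have hTT : ∀ m, T m ⊆ Icc a b := fun m t ht => ht.1
  have h0 := aux_T ξ hξ n hn η w a b hw m0
  have h1 := aux_T ξ hξ n hn η w a b hw (m0+1)
  calc _ ≤ volume.real ((T m0 ∪ T (m0 + 1)) ∪ ⋃ i ∈ Finset.range N, T (m0 + 2 + i)) := by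
        apply aux_mono a b hsub
        simp [hTT]
    _ ≤ (volume.real (T m0) + volume.real (T (m0+1))) +
          ∑ i ∈ Finset.range N, volume.real (T (m0 + 2 + i)) := by
        refine (measureReal_union_le _ _).trans ?_
        refine add_le_add (measureReal_union_le _ _) (measureReal_biUnion_finset_le _ _)
    _ ≤ (2 * w / (ξ * n * Real.exp (n * a)) + 2 * w / (ξ * n * Real.exp (n * a))) +
          ∑ i ∈ Finset.range N, 2 * w * (p (i+1) - p i) := by
        refine add_le_add (add_le_add h0 h1) (Finset.sum_le_sum fun i _ => hTi i)
    _ ≤ _ := by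
        rw [← Finset.mul_sum, Finset.sum_range_sub]
        have : p N - p 0 ≤ b - a := by linarith [(hpI N).2, (hpI 0).1]
        have := mul_le_mul_of_nonneg_left this (by positivity : 0 ≤ 2 * w)
        have e : 4 * w / (ξ * n * Real.exp (n * a)) = 2 * w / (ξ * n * Real.exp (n * a)) + 2 * w / (ξ * n * Real.exp (n * a)) := by ring
        linarith

lemma aux_split (U : Set ℝ) (a x y : ℝ) (hax : a ≤ x) (hxy : x ≤ y) :
    volume.real (U ∩ Icc x y) ≤ volume.real (U ∩ Icc a y) - volume.real (U ∩ Icc a x) := by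
  have hfin : volume (U ∩ Icc a y) ≠ ⊤ :=
    ((measure_mono inter_subset_right).trans_lt (by simp [Real.volume_Icc])).ne
  have h := measureReal_inter_add_sdiff (μ := volume) (s := U ∩ Icc a y) (measurableSet_Iic (a := x)) hfin
  have e1 : U ∩ Icc a y ∩ Iic x = U ∩ Icc a x := by
    ext t; simp only [mem_inter_iff, mem_Icc, mem_Iic]
    constructor
    · rintro ⟨⟨h1, h2, h3⟩, h4⟩; exact ⟨h1, h2, h4⟩
    · rintro ⟨h1, h2, h3⟩; exact ⟨⟨h1, h2, h3.trans hxy⟩, h3⟩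
  have e2 : U ∩ Icc x y ⊆ {x} ∪ (U ∩ Icc a y) \ Iic x := by
    rintro t ⟨h1, h2, h3⟩
    rcases eq_or_lt_of_le h2 with h | h
    · left; exact h.symm
    · right; exact ⟨⟨h1, by linarith, h3⟩, by simpa using h⟩
  have h3 : volume.real (U ∩ Icc x y) ≤ volume.real ({x} ∪ (U ∩ Icc a y) \ Iic x) := by
    apply aux_mono a y e2
    rintro t (h | h)
    · rw [mem_singleton_iff.mp h]; exact ⟨hax, hxy⟩
    · exact h.1.2
  have h4 := measureReal_union_le (μ := volume) {x} ((U ∩ Icc a y) \ Iic x)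
  have h5 : volume.real ({x} : Set ℝ) = 0 := by simp [Measure.real]
  rw [e1] at h
  linarith

lemma aux_avg (U W : Set ℝ) (a b : ℝ) (hab : a < b) (N : ℕ) (hN : 0 < N)
    (h : volume.real (U ∩ Icc a b) + 4 * volume.real (W ∩ Icc a b) < b - a) :
    ∃ a' b', a ≤ a' ∧ b' ≤ b ∧ b' - a' = (b - a) / N ∧
      volume.real (U ∩ Icc a' b') + 4 * volume.real (W ∩ Icc a' b') < b' - a' := by
  have hN' : (0:ℝ) < N := by exact_mod_cast hN
  set l := (b - a) / N with hl
  have hlpos : 0 < l := div_pos (by linarith) hN'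
  have hNl : N * l = b - a := by rw [hl]; field_simp
  set g : ℕ → ℝ := fun i => volume.real (U ∩ Icc a (a + i * l)) + 4 * volume.real (W ∩ Icc a (a + i * l)) with hg
  have key : ∃ i ∈ Finset.range N, g (i+1) - g i < l := by
    apply Finset.exists_lt_of_sum_lt
    rw [Finset.sum_range_sub]
    simp only [Finset.sum_const, Finset.card_range, nsmul_eq_mul]
    have h0 : 0 ≤ g 0 := by simp only [hg]; positivity
    have : g N < b - a := by
      simp only [hg]; rw [hNl]; simpa using h
    linarith
  obtain ⟨i, hi, hlt⟩ := key
  have hi' : ((i:ℝ) + 1) ≤ N := by exact_mod_cast Finset.mem_range.mp hi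
  have hi0 : 0 ≤ (i:ℝ) * l := by positivity
  refine ⟨a + i * l, a + (i + 1) * l, by linarith, ?_, by ring, ?_⟩
  · have := mul_le_mul_of_nonneg_right hi' hlpos.le
    linarith
  · have h1 := aux_split U a (a + i * l) (a + (i+1) * l) (by linarith) (by linarith)
    have h2 := aux_split W a (a + i * l) (a + (i+1) * l) (by linarith) (by linarith)
    simp only [hg] at hlt
    push_cast at hlt
    linarith

def Bset (ξ : ℝ) (η : ℕ → ℝ) (h : ℕ) (w : ℝ) (k : ℕ) : Set ℝ :=
  {t | ∃ n : ℕ, k * h < n ∧ n ≤ (k + 1) * h ∧ ∃ m : ℤ, |ξ * Real.exp (n * t) + η n - m| ≤ w}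

def IvlInv (ξ : ℝ) (η : ℕ → ℝ) (h : ℕ) (w s : ℝ) (k : ℕ) (p : ℝ × ℝ) : Prop :=
  p.1 < p.2 ∧ s ≤ p.1 ∧ p.2 ≤ 3 * s / 2 ∧ (k + 1) * (p.2 - p.1) ≤ s / 2 ∧
  1 ≤ ξ * ((k + 1) * h) * Real.exp ((k + 1) * h * p.1) * (p.2 - p.1) ∧
  volume.real (Bset ξ η h w k ∩ Icc p.1 p.2) ≤ (p.2 - p.1) / 4

lemma aux_block (ξ : ℝ) (hξ : 0 < ξ) (η : ℕ → ℝ) (h : ℕ) (hh : 0 < h) (w a b : ℝ) (hw : 0 < w)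
    (hw2 : w ≤ 1 / 2) (hab : a < b) (ha : 0 ≤ a) (k : ℕ) (R1 : w * h ≤ 1 / 96)
    (H : 1 ≤ ξ * ((k + 1) * h) * Real.exp ((k + 1) * h * a) * (b - a)) :
    volume.real (Bset ξ η h w (k + 1) ∩ Icc a b) ≤ (b - a) / 16 := by
  have hh' : (0:ℝ) < h := by exact_mod_cast hh
  have hsub : Bset ξ η h w (k + 1) ∩ Icc a b ⊆ ⋃ n ∈ Finset.Ioc ((k+1) * h) ((k+2) * h),
      {t | t ∈ Icc a b ∧ ∃ m : ℤ, |ξ * Real.exp (n * t) + η n - m| ≤ w} := by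
    rintro t ⟨⟨n, hn1, hn2, hm⟩, ht⟩
    simp only [mem_iUnion, Finset.mem_Ioc]
    exact ⟨n, ⟨hn1, by convert hn2 using 2⟩, ht, hm⟩
  have hl : 0 < b - a := by linarith
  have hone : ∀ n ∈ Finset.Ioc ((k+1) * h) ((k+2) * h),
      volume.real {t | t ∈ Icc a b ∧ ∃ m : ℤ, |ξ * Real.exp (n * t) + η n - m| ≤ w}
        ≤ 6 * w * (b - a) := by
    intro n hn
    rw [Finset.mem_Ioc] at hn
    have hn1 : 1 ≤ n := by omega
    have hnr : ((k:ℝ) + 1) * h ≤ n := by exact_mod_cast hn.1.le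
    have hn' : (0:ℝ) < n := by exact_mod_cast hn1
    refine (aux_meas ξ hξ n hn1 (η n) w a b hw hw2 hab.le).trans ?_
    have h1 : 1 ≤ ξ * n * Real.exp (n * a) * (b - a) := by
      refine H.trans ?_
      gcongr
    have h2 : 4 * w / (ξ * n * Real.exp (n * a)) ≤ 4 * w * (b - a) := by
      rw [div_le_iff₀ (by positivity)]
      nlinarith
    linarith
  calc _ ≤ volume.real (⋃ n ∈ Finset.Ioc ((k+1) * h) ((k+2) * h),
      {t | t ∈ Icc a b ∧ ∃ m : ℤ, |ξ * Real.exp (n * t) + η n - m| ≤ w}) := by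
        apply aux_mono a b hsub
        intro t ht
        simp only [mem_iUnion] at ht
        obtain ⟨n, _, ht⟩ := ht
        exact ht.1
    _ ≤ _ := measureReal_biUnion_finset_le _ _
    _ ≤ _ := Finset.sum_le_sum hone
    _ ≤ _ := by
      rw [Finset.sum_const, Nat.card_Ioc, nsmul_eq_mul]
      have : (k+2) * h - (k+1) * h = h := by
        rw [← Nat.sub_mul]; simp
      rw [this]
      nlinarith

lemma aux_step (ξ : ℝ) (hξ : 0 < ξ) (η : ℕ → ℝ) (h : ℕ) (hh : 0 < h) (w s : ℝ) (hw : 0 < w)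
    (hs : 0 < s) (hw2 : w ≤ 1 / 2) (R1 : w * h ≤ 1 / 96) (R2 : 4 ≤ w * Real.exp (h * s / 2))
    (R3 : 2 * w ≤ ξ * h * s) (k : ℕ) (p : ℝ × ℝ) (hp : IvlInv ξ η h w s k p) :
    ∃ q : ℝ × ℝ, IvlInv ξ η h w s (k+1) q ∧ p.1 ≤ q.1 ∧ q.2 ≤ p.2 ∧
      ∀ t ∈ Icc q.1 q.2, ∀ n : ℕ, k * h < n → n ≤ (k + 1) * h → ∀ m : ℤ,
        w / 2 < |ξ * Real.exp (n * t) + η n - m| := by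
  obtain ⟨a, b⟩ := p
  obtain ⟨hab, hsa, hbs, hk, H, hB⟩ := hp
  simp only at hab hsa hbs hk H hB ⊢
  have hh' : (0:ℝ) < h := by exact_mod_cast hh
  have hl : 0 < b - a := by linarith
  have hblk := aux_block ξ hξ η h hh w a b hw hw2 hab (by linarith) k R1 H
  set D := ξ * ((k + 1) * h) * Real.exp ((k + 1) * h * b) with hD
  have hDpos : 0 < D := by positivity
  have hDl : 1 ≤ D * (b - a) := by
    refine H.trans ?_
    rw [hD]; gcongr
  set N := ⌈2 * D * (b - a) / w⌉₊ with hN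
  have hx1 : 1 ≤ 2 * D * (b - a) / w := by
    rw [le_div_iff₀ hw]; linarith
  have hNpos : 0 < N := Nat.ceil_pos.mpr (by linarith)
  have hN' : (0:ℝ) < N := by exact_mod_cast hNpos
  have hN1 : 2 * D * (b - a) / w ≤ N := Nat.le_ceil _
  have hN2 : (N:ℝ) ≤ 4 * D * (b - a) / w := by
    have := (Nat.ceil_lt_add_one (by linarith : 0 ≤ 2 * D * (b - a) / w)).le
    have e : 4 * D * (b - a) / w = 2 * D * (b - a) / w + 2 * D * (b - a) / w := by ring
    linarith
  obtain ⟨a', b', ha', hb', hlen, hlt⟩ := aux_avg (Bset ξ η h w k) (Bset ξ η h w (k+1)) a b hab N hNpos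
    (by linarith)
  have hl' : 0 < b' - a' := by rw [hlen]; positivity
  have hU : 0 ≤ volume.real (Bset ξ η h w k ∩ Icc a' b') := measureReal_nonneg
  have hW : 0 ≤ volume.real (Bset ξ η h w (k+1) ∩ Icc a' b') := measureReal_nonneg
  have hlu : 2 * D * (b' - a') ≤ w := by
    rw [hlen]
    rw [div_le_iff₀ hw] at hN1
    rw [mul_div_assoc', div_le_iff₀ hN']; linarith
  have hll : w ≤ 4 * D * (b' - a') := by
    rw [hlen]
    rw [le_div_iff₀ hw] at hN2
    rw [mul_div_assoc', le_div_iff₀ hN']; linarith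
  refine ⟨(a', b'), ⟨by simp only; linarith, by simp only; linarith, by simp only; linarith, ?_, ?_, ?_⟩, ha', hb', ?_⟩
  · simp only
    push_cast
    have h1 : ξ * ((k + 1) * h) ≤ D := by
      rw [hD]
      have : 1 ≤ Real.exp ((k + 1) * h * b) := by
        apply Real.one_le_exp
        have : 0 ≤ b := by linarith
        positivity
      have h2 : 0 ≤ ξ * ((k + 1) * h) := by positivity
      nlinarith
    have h2 : 2 * (ξ * ((k + 1) * h)) * (b' - a') ≤ w := by
      refine le_trans ?_ hlu
      gcongr
    have h3 : (ξ * h) * ((k + 1 + 1) * (b' - a')) ≤ (ξ * h) * (s / 2) := by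
      have : (k:ℝ) + 1 + 1 ≤ 2 * (k + 1) := by have : (0:ℝ) ≤ k := Nat.cast_nonneg k; linarith
      calc (ξ * h) * ((k + 1 + 1) * (b' - a')) ≤ (ξ * h) * (2 * (k + 1) * (b' - a')) := by gcongr
        _ = 2 * (ξ * ((k + 1) * h)) * (b' - a') := by ring
        _ ≤ w := h2
        _ ≤ _ := by linarith
    exact le_of_mul_le_mul_left h3 (by positivity)
  · simp only
    push_cast
    have h1 : Real.exp ((k+1) * h * b) * Real.exp (h * s / 2) ≤ Real.exp ((k+1+1) * h * a') := by
      rw [← Real.exp_add]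
      apply Real.exp_le_exp.mpr
      have : (k+1) * b + s / 2 ≤ (k+1+1) * a' := by
        have : (k+1) * a ≤ (k+1) * a' := by gcongr
        nlinarith
      have := mul_le_mul_of_nonneg_left this hh'.le
      linarith
    have h2 : D * Real.exp (h * s / 2) ≤ ξ * ((k + 1 + 1) * h) * Real.exp ((k+1+1) * h * a') := by
      rw [hD, mul_assoc]
      gcongr
      linarith
    calc 1 ≤ w * Real.exp (h * s / 2) / 4 := by linarith
      _ ≤ 4 * D * (b' - a') * Real.exp (h * s / 2) / 4 := by gcongr
      _ = D * Real.exp (h * s / 2) * (b' - a') := by ring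
      _ ≤ _ := by gcongr
  · simp only
    linarith
  · intro t ht n hn1 hn2 m
    by_contra! hcon
    have hsub : Icc a' b' ⊆ Bset ξ η h w k := by
      intro x hx
      refine ⟨n, hn1, hn2, m, ?_⟩
      have hnr : (n:ℝ) ≤ (k+1) * h := by exact_mod_cast hn2
      have hup : ∀ x ∈ Icc a' b', ∀ y ∈ Icc a' b', x ≤ y →
          |ξ * Real.exp (n * y) - ξ * Real.exp (n * x)| ≤ w / 2 := by
        intro x hx y hy hxy
        have h0 := aux_exp_lower ξ hξ n x y
        have h1 := aux_exp_upper ξ hξ n x y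
        have hyx : 0 ≤ y - x := by linarith
        have hy0 : 0 ≤ y := by linarith [hy.1]
        have h00 : 0 ≤ ξ * n * Real.exp (n * x) * (y - x) := by positivity
        rw [abs_of_nonneg (by linarith)]
        have h2 : ξ * n * Real.exp (n * y) ≤ D := by
          rw [hD]
          have : y ≤ b := hy.2.trans hb'
          gcongr
        have h3 : ξ * n * Real.exp (n * y) * (y - x) ≤ D * (b' - a') := by
          have : y - x ≤ b' - a' := by linarith [hy.2, hx.1]
          gcongr
        linarith
      have h5 : |ξ * Real.exp (n * x) - ξ * Real.exp (n * t)| ≤ w / 2 := by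
        rcases le_total t x with h | h
        · exact hup t ht x hx h
        · rw [abs_sub_comm]; exact hup x hx t ht h
      rw [abs_le] at *
      constructor <;> linarith [h5.1, h5.2, hcon.1, hcon.2]
    rw [inter_eq_right.mpr hsub] at hlt
    rw [Real.volume_real_Icc_of_le (show a' ≤ b' by linarith)] at hlt
    linarith

lemma aux_core (ξ : ℝ) (hξ : 0 < ξ) (η : ℕ → ℝ) (h : ℕ) (hh : 0 < h) (w s : ℝ) (hw : 0 < w)
    (hs : 0 < s) (hw2 : w ≤ 1 / 2) (R1 : w * h ≤ 1 / 96) (R2 : 4 ≤ w * Real.exp (h * s / 2))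
    (R3 : 2 * w ≤ ξ * h * s) (R4 : 1 ≤ ξ * h * Real.exp (h * s) * (s / 2))
    (R5 : volume.real (Bset ξ η h w 0 ∩ Icc s (3 * s / 2)) ≤ s / 8) :
    ∃ t ∈ Icc s (3 * s / 2), ∀ n : ℕ, 1 ≤ n → ∀ m : ℤ,
      w / 2 < |ξ * Real.exp (n * t) + η n - m| := by
  have step : ∀ k (p : {p : ℝ × ℝ // IvlInv ξ η h w s k p}), ∃ q : {p : ℝ × ℝ // IvlInv ξ η h w s (k+1) p},
      p.1.1 ≤ q.1.1 ∧ q.1.2 ≤ p.1.2 ∧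
      ∀ t ∈ Icc q.1.1 q.1.2, ∀ n : ℕ, k * h < n → n ≤ (k + 1) * h → ∀ m : ℤ,
        w / 2 < |ξ * Real.exp (n * t) + η n - m| := by
    rintro k ⟨p, hp⟩
    obtain ⟨q, hq, h1⟩ := aux_step ξ hξ η h hh w s hw hs hw2 R1 R2 R3 k p hp
    exact ⟨⟨q, hq⟩, h1⟩
  choose nxt hn1 hn2 hn3 using step
  have h0 : IvlInv ξ η h w s 0 (s, 3 * s / 2) := by
    have e : 3 * s / 2 - s = s / 2 := by ring
    refine ⟨by simp only; linarith, by simp, by simp, ?_, ?_, ?_⟩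
    · simp only [e]; simp
    · simp only [e]; simpa using R4
    · simp only [e]; linarith
  let S : (k : ℕ) → {p : ℝ × ℝ // IvlInv ξ η h w s k p} := fun k => Nat.rec ⟨_, h0⟩ nxt k
  have hS : ∀ k, S (k+1) = nxt k (S k) := fun k => rfl
  have hanti : Antitone (fun k => Icc (S k).1.1 (S k).1.2) := by
    apply antitone_nat_of_succ_le
    intro k
    rw [hS]
    exact Icc_subset_Icc (hn1 k (S k)) (hn2 k (S k))
  have hmem := ciSup_mem_iInter_Icc_of_antitone_Icc hanti (fun k => (S k).2.1.le)
  rw [mem_iInter] at hmem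
  refine ⟨_, hmem 0, ?_⟩
  intro n hn m
  have hk := hmem ((n - 1) / h + 1)
  rw [hS] at hk
  refine hn3 _ _ _ hk n ?_ ?_ m
  · have := Nat.div_mul_le_self (n-1) h
    omega
  · have h2 : n - 1 < ((n-1)/h + 1) * h := by
      rw [mul_comm]; exact Nat.lt_mul_div_succ (n-1) hh
    omega

lemma aux_single (F : Finset ℕ) (g : ℕ → ℝ) (C : ℝ) (hC : 0 ≤ C) (h1 : ∀ j ∈ F, g j ≤ C)
    (h2 : ∀ i ∈ F, ∀ j ∈ F, i < j → g i ≠ 0 → g j ≠ 0 → False) : ∑ j ∈ F, g j ≤ C := by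
  by_cases h : ∃ j ∈ F, g j ≠ 0
  · obtain ⟨j, hj, hg⟩ := h
    rw [Finset.sum_eq_single_of_mem j hj]
    · exact h1 j hj
    · intro i hi hij
      by_contra hgi
      rcases lt_or_gt_of_ne hij with h | h
      · exact h2 i hi j hj h hgi hg
      · exact h2 j hj i hi h hg hgi
  · push Not at h
    rw [Finset.sum_eq_zero h]; exact hC

lemma aux_exp2 (x : ℝ) (hx : x ≤ 3 / 2) : Real.exp x ≤ 9 := by
  have h1 : Real.exp x ≤ Real.exp 2 := Real.exp_le_exp.mpr (by linarith)
  have h2 : Real.exp 2 = Real.exp 1 * Real.exp 1 := by rw [← Real.exp_add]; norm_num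
  have h3 := Real.exp_one_lt_d9
  have h4 := Real.exp_pos 1
  nlinarith

lemma aux_per_n (ξ : ℝ) (hξ : 0 < ξ) (η : ℝ) (n : ℕ) (hn : 1 ≤ n) (L : ℕ) (hL0 : 1 ≤ L)
    (hL : 1 ≤ ξ * L) (s w : ℕ → ℝ) (hs : ∀ j, s j = ((2:ℝ) ^ j)⁻¹)
    (hw : ∀ j, w j = s j / (1000 * L)) :
    ∑ j ∈ (Finset.Ico L (2 * L)).filter (fun j => n ≤ 2 ^ j),
      volume.real {t | t ∈ Icc (s j) (3 * s j / 2) ∧ ∃ m : ℤ, |ξ * Real.exp (n * t) + η - m| ≤ w j} * 2 ^ j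
      ≤ (9 * ξ + 4) / (500 * ξ * L) * (n:ℝ)⁻¹ := by
  have hn' : (0:ℝ) < n := by exact_mod_cast hn
  have hn1 : (1:ℝ) ≤ n := by exact_mod_cast hn
  have hL' : (0:ℝ) < L := by exact_mod_cast hL0
  have hL1 : (1:ℝ) ≤ L := by exact_mod_cast hL0
  have hspos : ∀ j, 0 < s j := fun j => by rw [hs]; positivity
  have hs1 : ∀ j, s j ≤ 1 := fun j => by
    rw [hs]; exact inv_le_one_of_one_le₀ (one_le_pow₀ (by norm_num))
  have hwpos : ∀ j, 0 < w j := fun j => by rw [hw]; have := hspos j; positivity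
  have hw1 : ∀ j, w j ≤ 1 := fun j => by
    rw [hw, div_le_one (by positivity)]; linarith [hs1 j]
  set G := (Finset.Ico L (2 * L)).filter (fun j => n ≤ 2 ^ j) with hG
  have hns : ∀ j ∈ G, n * s j ≤ 1 := by
    intro j hj
    have : n ≤ 2 ^ j := (Finset.mem_filter.mp hj).2
    have : (n:ℝ) ≤ 2 ^ j := by exact_mod_cast this
    rw [hs, ← div_eq_mul_inv]
    rw [div_le_one (by positivity)]; exact this
  let T : ℕ → ℤ → Set ℝ := fun j m =>
    {t | t ∈ Icc (s j) (3 * s j / 2) ∧ |ξ * Real.exp (n * t) + η - m| ≤ w j}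
  set F := Finset.Icc ⌈ξ + η - 1⌉ ⌊9 * ξ + η + 1⌋ with hF
  have hcard : (F.card : ℝ) ≤ 9 * ξ + 4 := by
    rw [hF, Int.card_Icc]
    have h1 := Int.floor_le (9 * ξ + η + 1)
    have h2 := Int.le_ceil (ξ + η - 1)
    have h3 : (((⌊9 * ξ + η + 1⌋ + 1 - ⌈ξ + η - 1⌉).toNat : ℤ) : ℝ) ≤ 9 * ξ + 4 := by
      rw [Int.toNat_eq_max]
      push_cast
      apply max_le <;> linarith
    exact_mod_cast h3
  have hone : ∀ j ∈ G, volume.real {t | t ∈ Icc (s j) (3 * s j / 2) ∧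
      ∃ m : ℤ, |ξ * Real.exp (n * t) + η - m| ≤ w j} * 2 ^ j ≤ ∑ m ∈ F, volume.real (T j m) * 2 ^ j := by
    intro j hj
    rw [← Finset.sum_mul]
    apply mul_le_mul_of_nonneg_right _ (by positivity)
    refine le_trans ?_ (measureReal_biUnion_finset_le F (T j))
    apply aux_mono (s j) (3 * s j / 2)
    · rintro t ⟨ht, m, hm⟩
      simp only [mem_iUnion]
      refine ⟨m, ?_, ht, hm⟩
      have h1 : n * t ≤ 3 / 2 := by
        have := mul_le_mul_of_nonneg_left ht.2 hn'.le
        linarith [hns j hj]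
      have h2 := aux_exp2 _ h1
      have h3 : 1 ≤ Real.exp (n * t) := by
        apply Real.one_le_exp
        have : 0 ≤ t := (hspos j).le.trans ht.1
        positivity
      have h4 := mul_le_mul_of_nonneg_left h2 hξ.le
      have h5 := mul_le_mul_of_nonneg_left h3 hξ.le
      have h6 := hw1 j
      rw [abs_le] at hm
      rw [hF, Finset.mem_Icc]
      constructor
      · apply Int.ceil_le.mpr; linarith
      · apply Int.le_floor.mpr; linarith
    · intro t ht
      simp only [mem_iUnion] at ht
      obtain ⟨m, _, ht⟩ := ht
      exact ht.1
  have hC : (0:ℝ) ≤ 1 / (500 * ξ * L) * (n:ℝ)⁻¹ := by positivity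
  have hm : ∀ m ∈ F, ∑ j ∈ G, volume.real (T j m) * 2 ^ j ≤ 1 / (500 * ξ * L) * (n:ℝ)⁻¹ := by
    intro m _
    apply aux_single _ _ _ hC
    · intro j hj
      have h1 := aux_T ξ hξ n hn η (w j) (s j) (3 * s j / 2) (hwpos j) m
      have h2 : 2 * w j / (ξ * n * Real.exp (n * s j)) ≤ 2 * w j / (ξ * n) := by
        have : 1 ≤ Real.exp (n * s j) := by
          apply Real.one_le_exp
          have := hspos j
          positivity
        apply div_le_div_of_nonneg_left
        · linarith [hwpos j]
        · positivity
        · have h0 : 0 < ξ * n := by positivity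
          nlinarith
      have h3 : volume.real (T j m) ≤ 2 * w j / (ξ * n) := h1.trans h2
      calc volume.real (T j m) * 2 ^ j ≤ 2 * w j / (ξ * n) * 2 ^ j := by gcongr
        _ = 1 / (500 * ξ * L) * (n:ℝ)⁻¹ := by
          rw [hw, hs]; field_simp; norm_num
    · intro i hi j hj hij hgi hgj
      have hne : ∀ i, volume.real (T i m) * 2 ^ i ≠ 0 → (T i m).Nonempty := by
        intro i hi
        by_contra hcon
        rw [Set.not_nonempty_iff_eq_empty] at hcon
        rw [hcon] at hi
        simp at hi
      obtain ⟨x, hx, hx2⟩ := hne i hgi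
      obtain ⟨y, hy, hy2⟩ := hne j hgj
      have hsij : s j ≤ s i / 2 := by
        have : (2:ℝ) ^ (i+1) ≤ 2 ^ j := pow_le_pow_right₀ (by norm_num) hij
        rw [hs, hs]
        calc ((2:ℝ) ^ j)⁻¹ ≤ (2 ^ (i+1))⁻¹ := by gcongr
          _ = _ := by rw [pow_succ]; field_simp
      have hwij : w j ≤ w i := by
        rw [hw, hw]
        have : s j ≤ s i := by linarith [hspos i]
        gcongr
      have h1 := aux_exp_lower ξ hξ n y x
      have hyx : s i / 4 ≤ x - y := by linarith [hx.1, hy.2]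
      have he : 1 ≤ Real.exp (n * y) := by
        apply Real.one_le_exp
        have : 0 ≤ y := (hspos j).le.trans hy.1
        positivity
      have h2 : ξ * 1 * 1 * (s i / 4) ≤ ξ * n * Real.exp (n * y) * (x - y) := by
        have := hspos i
        gcongr
      rw [abs_le] at hx2 hy2
      have h3 : ξ * (s i / 4) ≤ 2 * w i := by linarith
      have h4 : w i * (1000 * L) = s i := by rw [hw]; field_simp
      have h5 : w i ≤ w i * (ξ * L) := by have := hwpos i; nlinarith
      have h6 := hwpos i
      rw [← h4] at h3
      nlinarith
  calc _ ≤ ∑ j ∈ G, ∑ m ∈ F, volume.real (T j m) * 2 ^ j := Finset.sum_le_sum hone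
    _ = ∑ m ∈ F, ∑ j ∈ G, volume.real (T j m) * 2 ^ j := Finset.sum_comm
    _ ≤ ∑ m ∈ F, 1 / (500 * ξ * L) * (n:ℝ)⁻¹ := Finset.sum_le_sum hm
    _ = F.card * (1 / (500 * ξ * L) * (n:ℝ)⁻¹) := by rw [Finset.sum_const, nsmul_eq_mul]
    _ ≤ (9 * ξ + 4) * (1 / (500 * ξ * L) * (n:ℝ)⁻¹) := by gcongr
    _ = _ := by ring

lemma aux_pigeon (ξ : ℝ) (hξ : 0 < ξ) (η : ℕ → ℝ) (L : ℕ) (hL0 : 1 ≤ L)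
    (hL : ξ + 1000 ≤ ξ * L) (s w : ℕ → ℝ) (hs : ∀ j, s j = ((2:ℝ) ^ j)⁻¹)
    (hw : ∀ j, w j = s j / (1000 * L)) :
    ∃ j, L ≤ j ∧ j < 2 * L ∧ ∑ n ∈ Finset.Ioc (0:ℕ) (2 ^ j),
      volume.real {t | t ∈ Icc (s j) (3 * s j / 2) ∧ ∃ m : ℤ, |ξ * Real.exp (n * t) + η n - m| ≤ w j}
        ≤ s j / 16 := by
  have hL' : (0:ℝ) < L := by exact_mod_cast hL0
  have hL1 : (1:ℝ) ≤ L := by exact_mod_cast hL0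
  by_contra! hcon
  set V : ℕ → ℕ → ℝ := fun n j => volume.real {t | t ∈ Icc (s j) (3 * s j / 2) ∧
    ∃ m : ℤ, |ξ * Real.exp (n * t) + η n - m| ≤ w j} * 2 ^ j with hV
  have h1 : ∀ j ∈ Finset.Ico L (2 * L), (1:ℝ) / 16 ≤
      ∑ n ∈ Finset.Ioc (0:ℕ) (2 ^ (2 * L)), if n ≤ 2 ^ j then V n j else 0 := by
    intro j hj
    rw [Finset.mem_Ico] at hj
    have h2 := hcon j hj.1 hj.2
    rw [← Finset.sum_filter]
    have e : (Finset.Ioc 0 (2 ^ (2 * L))).filter (fun n => n ≤ 2 ^ j) = Finset.Ioc 0 (2 ^ j) := by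
      ext n
      simp only [Finset.mem_filter, Finset.mem_Ioc]
      have : 2 ^ j ≤ 2 ^ (2 * L) := Nat.pow_le_pow_right (by norm_num) hj.2.le
      constructor
      · rintro ⟨⟨a, b⟩, c⟩; exact ⟨a, c⟩
      · rintro ⟨a, c⟩; exact ⟨⟨a, c.trans this⟩, c⟩
    rw [e]
    simp only [hV]
    rw [← Finset.sum_mul]
    have h3 : s j * 2 ^ j = 1 := by rw [hs]; field_simp
    have h4 := mul_le_mul_of_nonneg_right h2.le (by positivity : (0:ℝ) ≤ 2 ^ j)
    linarith
  have h2 := Finset.sum_le_sum h1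
  rw [Finset.sum_comm, Finset.sum_const, Nat.card_Ico, nsmul_eq_mul] at h2
  have h3 : ∀ n ∈ Finset.Ioc (0:ℕ) (2 ^ (2 * L)), (∑ j ∈ Finset.Ico L (2 * L), if n ≤ 2 ^ j then V n j else 0)
      ≤ (9 * ξ + 4) / (500 * ξ * L) * (n:ℝ)⁻¹ := by
    intro n hn
    rw [← Finset.sum_filter]
    exact aux_per_n ξ hξ (η n) n (Finset.mem_Ioc.mp hn).1 L hL0 (by linarith) s w hs hw
  have h4 := h2.trans (Finset.sum_le_sum h3)
  rw [← Finset.mul_sum] at h4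
  have h5 : ∑ n ∈ Finset.Ioc (0:ℕ) (2 ^ (2 * L)), (n:ℝ)⁻¹ ≤ 3 * L := by
    have h := harmonic_le_one_add_log (2 ^ (2 * L))
    rw [harmonic_eq_sum_Icc] at h
    push_cast at h
    rw [Real.log_pow] at h
    have e : Finset.Ioc 0 (2 ^ (2 * L)) = Finset.Icc 1 (2 ^ (2 * L)) := by
      ext; simp [Nat.succ_le_iff]
    rw [e]
    refine h.trans ?_
    have := Real.log_two_lt_d9
    push_cast
    nlinarith
  have h6 : (9 * ξ + 4) / (500 * ξ * L) * ∑ n ∈ Finset.Ioc (0:ℕ) (2 ^ (2 * L)), (n:ℝ)⁻¹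
      ≤ (9 * ξ + 4) / (500 * ξ * L) * (3 * L) := by gcongr
  have h7 : (9 * ξ + 4) / (500 * ξ * L) * (3 * L) = 3 * (9 * ξ + 4) / (500 * ξ) := by field_simp
  have e : 2 * L - L = L := by omega
  rw [e] at h4
  have h8 : (L:ℝ) * (1 / 16) ≤ 3 * (9 * ξ + 4) / (500 * ξ) := by linarith
  rw [le_div_iff₀ (by positivity)] at h8
  nlinarith

lemma aux_R5 (ξ : ℝ) (hξ : 0 < ξ) (η : ℕ → ℝ) (L j : ℕ) (hL0 : 1 ≤ L)
    (hL : ξ + 1000 ≤ ξ * L) (s w : ℝ) (hs : s = ((2:ℝ) ^ j)⁻¹)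
    (hw : w = s / (1000 * L))
    (H : ∑ n ∈ Finset.Ioc (0:ℕ) (2 ^ j),
      volume.real {t | t ∈ Icc s (3 * s / 2) ∧ ∃ m : ℤ, |ξ * Real.exp (n * t) + η n - m| ≤ w}
        ≤ s / 16) :
    volume.real (Bset ξ η (8 * L * 2 ^ j) w 0 ∩ Icc s (3 * s / 2)) ≤ s / 8 := by
  have hL' : (0:ℝ) < L := by exact_mod_cast hL0
  have hL1 : (1:ℝ) ≤ L := by exact_mod_cast hL0
  have hspos : 0 < s := by rw [hs]; positivity
  have hs1 : s ≤ 1 := by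
    rw [hs]; exact inv_le_one_of_one_le₀ (one_le_pow₀ (by norm_num))
  have hwpos : 0 < w := by rw [hw]; positivity
  have hw1 : w ≤ 1 / 2 := by
    rw [hw, div_le_iff₀ (by positivity)]; linarith
  set h := 8 * L * 2 ^ j with hh
  have h2h : 2 ^ j ≤ h := by rw [hh]; exact Nat.le_mul_of_pos_left _ (by positivity)
  let U : ℕ → Set ℝ := fun n =>
    {t | t ∈ Icc s (3 * s / 2) ∧ ∃ m : ℤ, |ξ * Real.exp (n * t) + η n - m| ≤ w}
  have hsub : Bset ξ η h w 0 ∩ Icc s (3 * s / 2) ⊆ ⋃ n ∈ Finset.Ioc 0 h, U n := by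
    rintro t ⟨⟨n, hn1, hn2, hm⟩, ht⟩
    simp only [mem_iUnion, Finset.mem_Ioc]
    exact ⟨n, ⟨by simpa using hn1, by simpa using hn2⟩, ht, hm⟩
  have h1 : volume.real (Bset ξ η h w 0 ∩ Icc s (3 * s / 2)) ≤ ∑ n ∈ Finset.Ioc 0 h, volume.real (U n) := by
    refine le_trans ?_ (measureReal_biUnion_finset_le _ _)
    apply aux_mono _ _ hsub
    intro t ht
    simp only [mem_iUnion] at ht
    obtain ⟨n, _, ht⟩ := ht
    exact ht.1
  rw [← Finset.sum_Ioc_consecutive _ (Nat.zero_le _) h2h] at h1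
  have h2 : ∀ n ∈ Finset.Ioc (2 ^ j : ℕ) h, volume.real (U n) ≤ w * s + 4 * w / (ξ * s) * ((n:ℝ) ^ 2)⁻¹ := by
    intro n hn
    have hn0 : 1 ≤ n := Nat.lt_of_le_of_lt (Nat.zero_le _) (Finset.mem_Ioc.mp hn).1
    have hn' : (0:ℝ) < n := by exact_mod_cast hn0
    refine (aux_meas ξ hξ n hn0 (η n) w s (3 * s / 2) hwpos hw1 (by linarith)).trans ?_
    have e1 : 2 * w * (3 * s / 2 - s) = w * s := by ring
    rw [e1]
    have h3 : n * s ≤ Real.exp (n * s) := by linarith [Real.add_one_le_exp (n * s)]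
    have h4 : 4 * w / (ξ * n * Real.exp (n * s)) ≤ 4 * w / (ξ * n * (n * s)) := by gcongr
    have e2 : 4 * w / (ξ * n * (n * s)) = 4 * w / (ξ * s) * ((n:ℝ) ^ 2)⁻¹ := by field_simp
    linarith
  have h3 := Finset.sum_le_sum h2
  rw [Finset.sum_add_distrib, Finset.sum_const, Nat.card_Ioc, nsmul_eq_mul, ← Finset.mul_sum] at h3
  have h4 := sum_Ioc_inv_sq_le_sub (α := ℝ) (k := 2 ^ j) (n := h) (by positivity) h2h
  have h5 : ∑ n ∈ Finset.Ioc (2 ^ j : ℕ) h, ((n:ℝ) ^ 2)⁻¹ ≤ s := by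
    refine h4.trans ?_
    rw [hs]; push_cast
    have : (0:ℝ) ≤ (h:ℝ)⁻¹ := by positivity
    linarith
  have h6 : 4 * w / (ξ * s) * ∑ n ∈ Finset.Ioc (2 ^ j : ℕ) h, ((n:ℝ) ^ 2)⁻¹ ≤ s / 100 := by
    calc _ ≤ 4 * w / (ξ * s) * s := by gcongr
      _ = s * (4 / (1000 * (ξ * L))) := by rw [hw]; field_simp
      _ ≤ s * (1 / 100) := by
        apply mul_le_mul_of_nonneg_left _ hspos.le
        rw [div_le_iff₀ (by positivity)]
        linarith
      _ = _ := by ring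
  have h7 : ((h - 2 ^ j : ℕ) : ℝ) * (w * s) ≤ s / 96 := by
    have : ((h - 2 ^ j : ℕ) : ℝ) ≤ h := by exact_mod_cast Nat.sub_le _ _
    calc _ ≤ (h:ℝ) * (w * s) := by gcongr
      _ = s * (8 / 1000) := by rw [hh, hw, hs]; push_cast; field_simp
      _ ≤ _ := by linarith
  have H' : ∑ n ∈ Finset.Ioc (0:ℕ) (2 ^ j), volume.real (U n) ≤ s / 16 := H
  linarith

lemma aux_main (ξ : ℝ) (hξ : 0 < ξ) (η : ℕ → ℝ) (δ : ℝ) (hδ : 0 < δ) :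
    ∃ ε : ℝ, 0 < ε ∧ ε < δ ∧ ∀ n : ℕ, 1 ≤ n → ∀ m : ℤ,
      1 / 12000 * ε / |Real.log ε| < |ξ * (1 + ε) ^ n + η n - (m : ℝ)| := by
  obtain ⟨L, hL⟩ := exists_nat_gt (12 + (ξ + 1000) / ξ + 3 / δ)
  have hp1 : 0 < (ξ + 1000) / ξ := by positivity
  have hp2 : 0 < 3 / δ := by positivity
  have hL12 : (12:ℝ) ≤ L := by linarith
  have hL12n : 12 ≤ L := by exact_mod_cast hL12
  have hL' : (0:ℝ) < L := by linarith
  have hLξ : ξ + 1000 ≤ ξ * L := by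
    have : (ξ + 1000) / ξ ≤ L := by linarith
    rw [div_le_iff₀ hξ] at this; linarith
  have hLδ : 3 < δ * L := by
    have : 3 / δ < L := by linarith
    rw [div_lt_iff₀ hδ] at this; linarith
  obtain ⟨j, hj1, hj2, H⟩ := aux_pigeon ξ hξ η L (by omega) hLξ (fun j => ((2:ℝ) ^ j)⁻¹)
    (fun j => ((2:ℝ) ^ j)⁻¹ / (1000 * L)) (fun _ => rfl) (fun _ => rfl)
  set s : ℝ := ((2:ℝ) ^ j)⁻¹ with hs
  set w : ℝ := s / (1000 * L) with hw
  have R5 := aux_R5 ξ hξ η L j (by omega) hLξ s w hs hw H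
  have hspos : 0 < s := by rw [hs]; positivity
  have hwpos : 0 < w := by rw [hw]; positivity
  have hLtwo : (L:ℝ) < 2 ^ L := by exact_mod_cast Nat.lt_two_pow_self
  have hsL : s ≤ ((2:ℝ) ^ L)⁻¹ := by
    rw [hs]
    have : (2:ℝ) ^ L ≤ 2 ^ j := pow_le_pow_right₀ (by norm_num) hj1
    gcongr
  have h4096 : (4096:ℝ) ≤ 2 ^ L := by
    calc (4096:ℝ) = 2 ^ 12 := by norm_num
      _ ≤ 2 ^ L := pow_le_pow_right₀ (by norm_num) hL12n
  have hs1 : s ≤ 1 / 4096 := by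
    refine hsL.trans ?_
    rw [one_div]; gcongr
  have hsinv : s * L ≤ 1 := by
    calc s * L ≤ ((2:ℝ) ^ L)⁻¹ * 2 ^ L := by gcongr
      _ = 1 := by field_simp
  have hw1 : w ≤ 1 / 2 := by
    rw [hw, div_le_iff₀ (by positivity)]; linarith
  have hhs : ((8 * L * 2 ^ j : ℕ) : ℝ) * s = 8 * L := by
    rw [hs]; push_cast; field_simp
  have R1 : w * ((8 * L * 2 ^ j : ℕ) : ℝ) ≤ 1 / 96 := by
    have : w * ((8 * L * 2 ^ j : ℕ) : ℝ) = 8 / 1000 := by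
      rw [hw, div_mul_eq_mul_div, mul_comm s, hhs]; field_simp
    rw [this]; norm_num
  have R2 : 4 ≤ w * Real.exp (((8 * L * 2 ^ j : ℕ) : ℝ) * s / 2) := by
    rw [hhs]
    have h2e : (2:ℝ) ≤ Real.exp 1 := by linarith [Real.add_one_le_exp (1:ℝ)]
    have h1 : (2:ℝ) ^ (4 * L) ≤ Real.exp (8 * L / 2) := by
      calc (2:ℝ) ^ (4 * L) ≤ Real.exp 1 ^ (4 * L) := by gcongr
        _ = _ := by rw [← Real.exp_nat_mul]; congr 1; push_cast; ring
    have h2 : (2:ℝ) ^ (4 * L) = 2 ^ (2 * L) * (2 ^ L * 2 ^ L) := by rw [← pow_add, ← pow_add]; congr 1; ring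
    have h3 : (2:ℝ) ^ j ≤ 2 ^ (2 * L) := pow_le_pow_right₀ (by norm_num) hj2.le
    have h4 : (1:ℝ) ≤ s * 2 ^ (2 * L) := by
      rw [hs, inv_mul_eq_div, le_div_iff₀ (by positivity)]; linarith
    have h5 : 4096 * (L:ℝ) ≤ 2 ^ L * 2 ^ L := by gcongr
    calc (4:ℝ) ≤ 1 * (4096 * L) / (1000 * L) := by
          rw [le_div_iff₀ (by positivity)]; linarith
      _ ≤ (s * 2 ^ (2 * L)) * (2 ^ L * 2 ^ L) / (1000 * L) := by gcongr
      _ = w * 2 ^ (4 * L) := by rw [h2, hw]; ring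
      _ ≤ _ := by gcongr
  have R3 : 2 * w ≤ ξ * ((8 * L * 2 ^ j : ℕ) : ℝ) * s := by
    rw [mul_assoc, hhs]; linarith
  have R4 : 1 ≤ ξ * ((8 * L * 2 ^ j : ℕ) : ℝ) * Real.exp (((8 * L * 2 ^ j : ℕ) : ℝ) * s) * (s / 2) := by
    have e : ξ * ((8 * L * 2 ^ j : ℕ) : ℝ) * Real.exp (((8 * L * 2 ^ j : ℕ) : ℝ) * s) * (s / 2)
      = 4 * (ξ * L) * Real.exp (8 * L) := by
        rw [hhs]
        calc _ = ξ * (((8 * L * 2 ^ j : ℕ) : ℝ) * s) * Real.exp (8 * L) / 2 := by ring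
          _ = _ := by rw [hhs]; ring
    rw [e]
    have : 1 ≤ Real.exp (8 * (L:ℝ)) := Real.one_le_exp (by positivity)
    nlinarith
  obtain ⟨t, ht, hfin⟩ := aux_core ξ hξ η (8 * L * 2 ^ j) (by positivity) w s hwpos hspos hw1 R1 R2 R3 R4 R5
  have htpos : 0 < t := hspos.trans_le ht.1
  have hε1 : t ≤ Real.exp t - 1 := by linarith [Real.add_one_le_exp t]
  have hε2 : Real.exp t - 1 ≤ 2 * t := by
    have h1 := Real.add_one_le_exp (-t)
    have h2 : Real.exp (-t) * Real.exp t = 1 := by rw [← Real.exp_add]; simp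
    have h3 := Real.exp_pos t
    have h4 : t ≤ 1 / 2 := by linarith [ht.2]
    nlinarith
  have hε3 : Real.exp t - 1 ≤ 3 * s := by linarith [ht.2]
  refine ⟨Real.exp t - 1, by linarith, ?_, ?_⟩
  · have : 3 * s < δ := by nlinarith
    linarith
  · intro n hn m
    have h1 := hfin n hn m
    have e : ξ * (1 + (Real.exp t - 1)) ^ n = ξ * Real.exp (n * t) := by
      rw [Real.exp_nat_mul]; congr 2; ring
    rw [e]
    refine lt_of_le_of_lt ?_ h1
    set ε := Real.exp t - 1 with hε
    have hεpos : 0 < ε := by linarith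
    have hlog : L / 2 ≤ |Real.log ε| := by
      have h2 : Real.log ε ≤ Real.log (4 * ((2:ℝ) ^ L)⁻¹) := by
        apply Real.log_le_log hεpos; linarith
      have h3 : Real.log (4 * ((2:ℝ) ^ L)⁻¹) = 2 * Real.log 2 - L * Real.log 2 := by
        rw [Real.log_mul (by norm_num) (by positivity), Real.log_inv, Real.log_pow,
          show (4:ℝ) = 2 ^ 2 by norm_num, Real.log_pow]
        push_cast; ring
      have h4 := Real.log_two_gt_d9
      have h5 := Real.log_two_lt_d9
      have : L / 2 ≤ - Real.log ε := by nlinarith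
      exact this.trans (neg_le_abs _)
    calc 1 / 12000 * ε / |Real.log ε| ≤ 1 / 12000 * (3 * s) / (L / 2) := by gcongr
      _ = w / 2 := by rw [hw]; field_simp; norm_num

theorem stmt_5 (M : ℝ) (hM : 0 < M) :
    ∃ γ : ℝ, 0 < γ ∧
      ∀ ξ : ℝ, ξ ≠ 0 → |ξ| ≤ M → ∀ η : ℕ → ℝ,
        ∀ δ : ℝ, 0 < δ → ∃ ε : ℝ, 0 < ε ∧ ε < δ ∧
          ∀ n : ℕ, 1 ≤ n → ∀ m : ℤ,
            γ * ε / |Real.log ε| < |ξ * (1 + ε) ^ n + η n - (m : ℝ)| := by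
  refine ⟨1 / 12000, by norm_num, ?_⟩
  intro ξ hξ _ η δ hδ
  rcases lt_or_gt_of_ne hξ with h | h
  · obtain ⟨ε, h1, h2, h3⟩ := aux_main (-ξ) (by linarith) (fun n => - η n) δ hδ
    refine ⟨ε, h1, h2, ?_⟩
    intro n hn m
    have := h3 n hn (-m)
    have e : -ξ * (1 + ε) ^ n + -η n - ((-m : ℤ) : ℝ) = -(ξ * (1 + ε) ^ n + η n - (m : ℝ)) := by
      push_cast; ring
    rw [e, abs_neg] at this
    exact this
  · exact aux_main ξ h η δ hδ
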